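/- Gaussian averaging preserves and detects vanishing at infinity: let f be a bounded, uniformly continuous function on R^d. Then the convolution f * G, with G(x) = exp(−π|x|²), belongs to C₀(R^d) if and only if f ∈ C₀(R^d). -/

import Mathlib

open MeasureTheory Filter

section helpers

open scoped FourierTransform SchwartzMap ContDiff RealInnerProductSpace

variable {V : Type*} [NormedAddCommGroup V] [InnerProductSpace ℝ V] [FiniteDimensional ℝ V]
  [MeasurableSpace V] [BorelSpace V]

lemma aux_tendsto (f k : V → ℂ) (hf : Continuous f) (M : ℝ) (hb : ∀ x, ‖f x‖ ≤ M)
    (hk : Integrable k) (h0 : Tendsto f (cocompact V) (nhds 0)) :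
    Tendsto (fun x => ∫ y, f (x - y) * k y) (cocompact V) (nhds 0) := by
  have hcg : (cocompact V).IsCountablyGenerated := by
    rw [← Metric.cobounded_eq_cocompact, ← comap_norm_atTop]
    infer_instance
  have : (0 : ℂ) = ∫ y : V, (0 : ℂ) := by simp
  rw [this]
  refine tendsto_integral_filter_of_dominated_convergence (fun y => M * ‖k y‖) ?_ ?_ ?_ ?_
  · refine Eventually.of_forall fun x => ?_
    exact (by fun_prop : Continuous fun y => f (x - y)).aestronglyMeasurable.mul hk.1
  · refine Eventually.of_forall fun x => Eventually.of_forall fun y => ?_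
    rw [norm_mul]
    exact mul_le_mul_of_nonneg_right (hb _) (norm_nonneg _)
  · exact hk.norm.const_mul M
  · refine Eventually.of_forall fun y => ?_
    have h1 : Tendsto (fun x : V => x - y) (cocompact V) (cocompact V) :=
      (Homeomorph.subRight y).isClosedEmbedding.tendsto_cocompact
    simpa using (h0.comp h1).mul_const (k y)

lemma aux_cont (f k : V → ℂ) (hf : Continuous f) (M : ℝ) (hb : ∀ x, ‖f x‖ ≤ M)
    (hk : Integrable k) : Continuous (fun x => ∫ y, f (x - y) * k y) := by
  refine continuous_of_dominated (bound := fun y => M * ‖k y‖) ?_ ?_ ?_ ?_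
  · intro x
    exact (by fun_prop : Continuous fun y => f (x - y)).aestronglyMeasurable.mul hk.1
  · refine fun x => Eventually.of_forall fun y => ?_
    rw [norm_mul]
    exact mul_le_mul_of_nonneg_right (hb _) (norm_nonneg _)
  · exact hk.norm.const_mul M
  · exact Eventually.of_forall fun y => by fun_prop

lemma aux_bound (f k : V → ℂ) (M : ℝ) (hb : ∀ x, ‖f x‖ ≤ M)
    (hk : Integrable k) (x : V) : ‖∫ y, f (x - y) * k y‖ ≤ ∫ y, M * ‖k y‖ := by
  refine norm_integral_le_of_norm_le (hk.norm.const_mul M) (Eventually.of_forall fun y => ?_)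
  rw [norm_mul]
  exact mul_le_mul_of_nonneg_right (hb _) (norm_nonneg _)

/-- associativity -/
lemma aux_assoc (f g φ : V → ℂ) (hf : Continuous f) (M : ℝ) (hb : ∀ x, ‖f x‖ ≤ M)
    (hg : Integrable g) (hφ : Integrable φ) (x : V) :
    ∫ z, (∫ y, f (x - z - y) * g y) * φ z = ∫ w, f (x - w) * ∫ z, φ z * g (w - z) := by
  have hint : Integrable (fun p : V × V => f (x - p.1) * (φ p.2 * g (p.1 - p.2)))
      (volume.prod volume) := by
    have h := hφ.convolution_integrand (ContinuousLinearMap.mul ℝ ℂ) hg (μ := volume)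
    refine Integrable.bdd_mul (c := M) h ?_ ?_
    · exact (by fun_prop : Continuous fun p : V × V => f (x - p.1)).aestronglyMeasurable
    · exact Eventually.of_forall fun p => hb _
  calc ∫ z, (∫ y, f (x - z - y) * g y) * φ z
      = ∫ z, ∫ w, f (x - w) * (φ z * g (w - z)) := by
        congr 1; ext z
        rw [← integral_sub_right_eq_self _ z, ← integral_mul_const]
        congr 1; ext w
        rw [show x - z - (w - z) = x - w by abel]; ring
    _ = ∫ w, ∫ z, f (x - w) * (φ z * g (w - z)) := by
        rw [integral_integral_swap]
        exact hint.swap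
    _ = _ := by
        congr 1; ext w
        rw [integral_const_mul]

lemma gauss_int : Integrable (fun y : V => ((Real.exp (-Real.pi * ‖y‖^2) : ℝ) : ℂ)) := by
  have := GaussianFourier.integrable_cexp_neg_mul_sq_norm_add (V := V) (b := Real.pi)
    (by simpa using Real.pi_pos) 0 0
  simpa using this

/-- `G * φ` is the inverse Fourier transform of `G · 𝓕 φ`. -/
lemma gauss_conv (φ : 𝓢(V, ℂ)) (x : V) :
    ∫ z, φ z * ((Real.exp (-Real.pi * ‖x - z‖^2) : ℝ) : ℂ) =
      ∫ ξ, Complex.exp (2 * Real.pi * Complex.I * ⟪x, ξ⟫) *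
        (𝓕 (φ : V → ℂ) ξ * ((Real.exp (-Real.pi * ‖ξ‖^2) : ℝ) : ℂ)) := by
  have hre : 0 < ((Real.pi : ℂ)).re := by simpa using Real.pi_pos
  have hpi : (Real.pi : ℂ) ≠ 0 := by simpa using Real.pi_ne_zero
  have hG := GaussianFourier.integrable_cexp_neg_mul_sq_norm_add (V := V) (b := Real.pi)
    hre (2 * Real.pi * Complex.I) x
  have h := VectorFourier.integral_fourierIntegral_smul_eq_flip (L := innerₗ V)
      Real.continuous_fourierChar continuous_inner (φ.integrable (μ := volume)) hG
  have e1 : ∀ z, 𝓕 (fun v : V => Complex.exp (-(Real.pi : ℂ) * ‖v‖ ^ 2 +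
      2 * Real.pi * Complex.I * ⟪x, v⟫)) z = ((Real.exp (-Real.pi * ‖x - z‖^2) : ℝ) : ℂ) := by
    intro z
    rw [fourier_gaussian_innerProductSpace' hre]
    rw [div_self hpi, Complex.one_cpow, one_mul]
    push_cast
    congr 1
    field_simp
  have h2 : ∫ ξ, 𝓕 (φ : V → ℂ) ξ * Complex.exp (-(Real.pi : ℂ) * ‖ξ‖ ^ 2 +
      2 * Real.pi * Complex.I * ⟪x, ξ⟫) = ∫ z, φ z * 𝓕 (fun v : V => Complex.exp (-(Real.pi : ℂ) * ‖v‖ ^ 2 +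
      2 * Real.pi * Complex.I * ⟪x, v⟫)) z := by
    simpa using! h
  simp_rw [e1] at h2
  rw [← h2]
  congr 1; ext ξ
  rw [Complex.exp_add]
  push_cast
  ring

/-- An approximate identity in the ideal generated by the Gaussian. -/
lemma approx_exists (χ : V → ℂ) (hχ : HasCompactSupport χ) (hs : ContDiff ℝ ∞ χ)
    (a : ℝ) (ha : 0 < a) (f : V → ℂ) (hf : Continuous f) (M : ℝ) (hb : ∀ x, ‖f x‖ ≤ M) :
    ∃ φ : 𝓢(V, ℂ), ∀ x, ∫ z, (∫ y, f (x - z - y) *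
      ((Real.exp (-Real.pi * ‖y‖^2) : ℝ) : ℂ)) * φ z =
      ∫ y, f (x - a • y) * 𝓕⁻ χ y := by
  let ψ : V → ℂ := fun ξ => χ (a • ξ) * ((Real.exp (Real.pi * ‖ξ‖^2) : ℝ) : ℂ)
  have hψc : HasCompactSupport ψ :=
    (hχ.comp_homeomorph (Homeomorph.smulOfNeZero a ha.ne')).mul_right
  have hψs : ContDiff ℝ ∞ ψ := by
    refine ContDiff.mul (hs.comp (contDiff_const_smul a)) ?_
    exact Complex.ofRealCLM.contDiff.comp
      (Real.contDiff_exp.comp (contDiff_const.mul (contDiff_norm_sq ℝ)))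
  let Ψ : 𝓢(V, ℂ) := hψc.toSchwartzMap hψs
  refine ⟨𝓕⁻ Ψ, fun x => ?_⟩
  have hF : 𝓕 ((𝓕⁻ Ψ : 𝓢(V, ℂ)) : V → ℂ) = ψ := by
    rw [← SchwartzMap.fourier_coe, FourierTransform.fourier_fourierInv_eq]
    rfl
  rw [aux_assoc f _ _ hf M hb gauss_int (𝓕⁻ Ψ : 𝓢(V, ℂ)).integrable x]
  simp_rw [gauss_conv, hF]
  have hk : ∀ w ξ : V, Complex.exp (2 * Real.pi * Complex.I * ⟪w, ξ⟫) *
        (ψ ξ * ((Real.exp (-Real.pi * ‖ξ‖^2) : ℝ) : ℂ)) =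
        Complex.exp (2 * Real.pi * Complex.I * ⟪w, ξ⟫) * χ (a • ξ) := by
    intro w ξ
    simp only [ψ]
    rw [mul_assoc (χ _), ← Complex.ofReal_mul, ← Real.exp_add]
    simp
  simp_rw [hk]
  have hd : 0 < a ^ Module.finrank ℝ V := by positivity
  have hH : ∀ y, 𝓕⁻ χ y = (a ^ Module.finrank ℝ V) •
      ∫ ξ, Complex.exp (2 * Real.pi * Complex.I * ⟪a • y, ξ⟫) * χ (a • ξ) := by
    intro y
    have := Measure.integral_comp_smul_of_nonneg (volume : Measure V)
      (fun ξ => Complex.exp (2 * Real.pi * Complex.I * ⟪y, ξ⟫) * χ ξ) a (hR := ha.le)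
    have e : ∀ ξ : V, ⟪a • y, ξ⟫ = ⟪y, a • ξ⟫ := fun ξ => by
      rw [real_inner_smul_left, real_inner_smul_right]
    simp_rw [e]
    rw [this, smul_inv_smul₀ hd.ne', Real.fourierInv_eq']
    congr 1; ext ξ
    rw [smul_eq_mul, real_inner_comm]
    congr 2
    push_cast; ring
  simp_rw [hH]
  have := Measure.integral_comp_smul_of_nonneg (volume : Measure V)
      (fun w => f (x - w) * ∫ ξ, Complex.exp (2 * Real.pi * Complex.I * ⟪w, ξ⟫) * χ (a • ξ))
      a (hR := ha.le)
  simp_rw [mul_smul_comm]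
  rw [integral_smul, this, smul_inv_smul₀ hd.ne']

lemma unif_approx (f : V → ℂ) (hu : UniformContinuous f) (M : ℝ) (hb : ∀ x, ‖f x‖ ≤ M)
    (K : 𝓢(V, ℂ)) (hK : ∫ y, K y = 1) (ε : ℝ) (hε : 0 < ε) :
    ∃ a : ℝ, 0 < a ∧ ∀ x, ‖(∫ y, f (x - a • y) * K y) - f x‖ ≤ ε := by
  have hM : 0 ≤ M := (norm_nonneg _).trans (hb 0)
  have hKi : Integrable (K : V → ℂ) := K.integrable
  have hK1 : Integrable (fun y => ‖y‖ * ‖K y‖) := by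
    simpa using K.integrable_pow_mul (volume : Measure V) 1
  set A := ∫ y, ‖K y‖ with hA
  set B := ∫ y, ‖y‖ * ‖K y‖ with hB
  have hA0 : 0 ≤ A := integral_nonneg fun y => norm_nonneg _
  have hB0 : 0 ≤ B := integral_nonneg fun y => by positivity
  obtain ⟨δ, hδ, hfδ⟩ := Metric.uniformContinuous_iff.1 hu (ε / (2 * (A + 1))) (by positivity)
  set η := ε / (2 * (A + 1)) with hη
  have hη0 : 0 < η := by positivity
  set a := ε * δ / (4 * (M + 1) * (B + 1)) with haa
  have ha : 0 < a := by positivity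
  refine ⟨a, ha, fun x => ?_⟩
  have hfc := hu.continuous
  have hi : Integrable (fun y => f (x - a • y) * K y) := by
    refine hKi.bdd_mul (c := M) ?_ (Eventually.of_forall fun y => hb _)
    exact (by fun_prop : Continuous fun y => f (x - a • y)).aestronglyMeasurable
  have e : (∫ y, f (x - a • y) * K y) - f x = ∫ y, (f (x - a • y) - f x) * K y := by
    simp_rw [sub_mul]
    rw [integral_sub hi (hKi.const_mul _), integral_const_mul, hK, mul_one]
  rw [e]
  have hpt : ∀ y, ‖f (x - a • y) - f x‖ ≤ η + 2 * M * a / δ * ‖y‖ := by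
    intro y
    by_cases hy : a * ‖y‖ < δ
    · have : dist (x - a • y) x < δ := by
        simpa [dist_eq_norm, norm_smul, abs_of_pos ha] using hy
      have := (hfδ this).le
      rw [dist_eq_norm] at this
      have : 0 ≤ 2 * M * a / δ * ‖y‖ := by positivity
      linarith
    · push Not at hy
      have h1 : ‖f (x - a • y) - f x‖ ≤ 2 * M :=
        (norm_sub_le _ _).trans (by linarith [hb (x - a • y), hb x])
      have h2 : 2 * M ≤ 2 * M * a / δ * ‖y‖ := by
        have : 1 ≤ a * ‖y‖ / δ := by rwa [le_div_iff₀ hδ, one_mul]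
        calc 2 * M = 2 * M * 1 := by ring
          _ ≤ 2 * M * (a * ‖y‖ / δ) := by gcongr
          _ = _ := by ring
      linarith
  calc ‖∫ y, (f (x - a • y) - f x) * K y‖
      ≤ ∫ y, (η * ‖K y‖ + 2 * M * a / δ * (‖y‖ * ‖K y‖)) := by
        refine norm_integral_le_of_norm_le ((hKi.norm.const_mul _).add (hK1.const_mul _))
          (Eventually.of_forall fun y => ?_)
        rw [norm_mul]
        calc _ ≤ (η + 2 * M * a / δ * ‖y‖) * ‖K y‖ :=
              mul_le_mul_of_nonneg_right (hpt y) (norm_nonneg _)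
          _ = _ := by ring
    _ = η * A + 2 * M * a / δ * B := by
        rw [integral_add (hKi.norm.const_mul _) (hK1.const_mul _), integral_const_mul,
          integral_const_mul]
    _ ≤ ε / 2 + ε / 2 := by
        gcongr
        · rw [hη, div_mul_eq_mul_div, div_le_div_iff₀ (by positivity) (by positivity)]
          nlinarith
        · have : 2 * M * a / δ * B = ε / 2 * ((M / (M + 1)) * (B / (B + 1))) := by
            rw [haa]; field_simp; ring
          rw [this]
          have h1 : M / (M + 1) ≤ 1 := by rw [div_le_one (by positivity)]; linarith
          have h2 : B / (B + 1) ≤ 1 := by rw [div_le_one (by positivity)]; linarith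
          have h3 : (M / (M + 1)) * (B / (B + 1)) ≤ 1 := mul_le_one₀ h1 (by positivity) h2
          nlinarith
    _ = ε := by ring

lemma main_aux (f : V → ℂ) (hu : UniformContinuous f) (M : ℝ) (hb : ∀ x, ‖f x‖ ≤ M) :
    Tendsto (fun x => ∫ y, f (x - y) * ((Real.exp (-Real.pi * ‖y‖^2) : ℝ) : ℂ))
        (cocompact V) (nhds 0) ↔ Tendsto f (cocompact V) (nhds 0) := by
  have hfc := hu.continuous
  refine ⟨fun h => ?_, fun h => aux_tendsto f _ hfc M hb gauss_int h⟩
  let β : ContDiffBump (0 : V) := ⟨1, 2, one_pos, one_lt_two⟩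
  let χ : V → ℂ := fun x => ((β x : ℝ) : ℂ)
  have hχs : ContDiff ℝ ∞ χ := Complex.ofRealCLM.contDiff.comp β.contDiff
  have hχc : HasCompactSupport χ :=
    β.hasCompactSupport.comp_left (g := fun r : ℝ => (r : ℂ)) (by simp)
  let X : 𝓢(V, ℂ) := hχc.toSchwartzMap hχs
  let K : 𝓢(V, ℂ) := 𝓕⁻ X
  have hKe : (K : V → ℂ) = 𝓕⁻ χ := SchwartzMap.fourierInv_coe X
  have hK : ∫ y, K y = 1 := by
    have h1 : 𝓕 (K : V → ℂ) 0 = 1 := by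
      have : 𝓕 K = X := FourierTransform.fourier_fourierInv_eq X
      rw [← SchwartzMap.fourier_coe, this]
      change ((β 0 : ℝ) : ℂ) = 1
      rw [β.one_of_mem_closedBall (by simp [β])]
      simp
    rw [Real.fourier_eq] at h1
    simpa using h1
  rw [Metric.tendsto_nhds]
  intro ε hε
  obtain ⟨a, ha, hap⟩ := unif_approx f hu M hb K hK (ε / 2) (by positivity)
  obtain ⟨φ, hφ⟩ := approx_exists χ hχc hχs a ha f hfc M hb
  have ht := aux_tendsto _ φ (aux_cont f _ hfc M hb gauss_int) _
    (aux_bound f _ M hb gauss_int) φ.integrable h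
  rw [Metric.tendsto_nhds] at ht
  filter_upwards [ht (ε / 2) (by positivity)] with x hx
  rw [hφ x, dist_zero_right, ← hKe] at hx
  rw [dist_zero_right]
  have h3 := hap x
  rw [norm_sub_rev] at h3
  calc ‖f x‖ = ‖(f x - ∫ y, f (x - a • y) * K y) + ∫ y, f (x - a • y) * K y‖ := by
        rw [sub_add_cancel]
    _ ≤ _ := norm_add_le _ _
    _ < ε := by linarith

end helpers


/-- Gaussian averaging preserves and detects vanishing at infinity: for a bounded,
uniformly continuous function `f` on `ℝ^d`, the convolution `f * G` with the Gaussian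
`G(x) = exp(−π|x|²)` vanishes at infinity if and only if `f` does. -/
theorem stmt_15 (d : ℕ) (f : EuclideanSpace ℝ (Fin d) → ℂ)
    (hu : UniformContinuous f) (M : ℝ) (hb : ∀ x, ‖f x‖ ≤ M) :
    Tendsto (fun x => ∫ y, f (x - y) * (Real.exp (-Real.pi * ‖y‖^2) : ℝ))
        (cocompact (EuclideanSpace ℝ (Fin d))) (nhds 0)
    ↔ Tendsto f (cocompact (EuclideanSpace ℝ (Fin d))) (nhds 0) := by
  exact main_aux f hu M hb
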